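/- Let A and B be symmetric 2×2 real matrices. Then (trace A)²/4 + (trace B)²/4 - det A - det B - (A*B - B*A) 0 1 = 0 holds if and only if there exist real numbers μ, γ, θ, φ such that, with R the rotation matrix ![![cos θ, -sin θ], ![sin θ, cos θ]], one has Rᵀ * (cos φ • A + sin φ • B) * R = ![![μ + 2γ, 0], ![0, μ]] and Rᵀ * (-sin φ • A + cos φ • B) * R = ![![0, γ], ![γ, 0]]. -/

import Mathlib

open Matrix Real

theorem exists_polar_coordinates (x y : ℝ) :
    ∃ r t : ℝ, x = r * Real.cos t ∧ y = r * Real.sin t :=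
  ⟨‖(⟨x, y⟩ : ℂ)‖, Complex.arg ⟨x, y⟩,
    (Complex.norm_mul_cos_arg ⟨x, y⟩).symm, (Complex.norm_mul_sin_arg ⟨x, y⟩).symm⟩

theorem eq_zero_of_rotation_eq_zero {c s x y : ℝ} (h : c ^ 2 + s ^ 2 = 1)
    (h₁ : c * x + s * y = 0) (h₂ : c * y - s * x = 0) : x = 0 ∧ y = 0 :=
  ⟨by linear_combination c * h₁ - s * h₂ - x * h,
    by linear_combination s * h₁ + c * h₂ - y * h⟩

theorem Matrix.IsSymm.eq_fin_two {A : Matrix (Fin 2) (Fin 2) ℝ} (hA : A.IsSymm) :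
    A = !![A 0 0, A 0 1; A 0 1, A 1 1] := by
  conv_lhs => rw [Matrix.eta_fin_two A, hA.apply 0 1]

/-- The Wintgen defect is a sum of two squares, so it vanishes iff both linear forms do. -/
theorem wintgen_defect_eq_zero_iff (a b c d e f : ℝ) :
    (!![a, b; b, c]).trace ^ 2 / 4 + (!![d, e; e, f]).trace ^ 2 / 4
        - (!![a, b; b, c]).det - (!![d, e; e, f]).det
        - (!![a, b; b, c] * !![d, e; e, f] - !![d, e; e, f] * !![a, b; b, c]) 0 1 = 0 ↔
      a - c - 2 * e = 0 ∧ 2 * b + d - f = 0 := by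
  simp only [Matrix.trace_fin_two_of, Matrix.det_fin_two_of, Matrix.sub_apply,
    Matrix.mul_apply, Fin.sum_univ_two, Matrix.of_apply, Matrix.cons_val_zero,
    Matrix.cons_val_one, Matrix.cons_val', Matrix.cons_val_fin_one]
  constructor
  · intro h
    constructor <;> nlinarith [sq_nonneg (a - c - 2 * e), sq_nonneg (2 * b + d - f)]
  · rintro ⟨h₁, h₂⟩
    linear_combination (a - c - 2 * e) / 4 * h₁ + (2 * b + d - f) / 4 * h₂

theorem rotation_conj_fin_two (u v a b c : ℝ) :
    (!![u, -v; v, u])ᵀ * !![a, b; b, c] * !![u, -v; v, u] =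
      !![u ^ 2 * a + 2 * u * v * b + v ^ 2 * c, (u ^ 2 - v ^ 2) * b - u * v * (a - c);
        (u ^ 2 - v ^ 2) * b - u * v * (a - c), v ^ 2 * a - 2 * u * v * b + u ^ 2 * c] := by
  ext i j
  fin_cases i <;> fin_cases j <;>
    simp [Matrix.mul_apply, Fin.sum_univ_two] <;> ring

theorem smul_add_smul_fin_two (x y a b c d e f : ℝ) :
    x • !![a, b; b, c] + y • !![d, e; e, f] =
      !![x * a + y * d, x * b + y * e; x * b + y * e, x * c + y * f] := by
  ext i j
  fin_cases i <;> fin_cases j <;> simp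

theorem of_fin_two_eq_iff (a b c d a' b' c' d' : ℝ) :
    !![a, b; c, d] = !![a', b'; c', d'] ↔ a = a' ∧ b = b' ∧ c = c' ∧ d = d' := by
  simp [and_assoc]

theorem wintgen_type_equality_case_indefinite
    (A B : Matrix (Fin 2) (Fin 2) ℝ) (hA : A.IsSymm) (hB : B.IsSymm) :
    A.trace ^ 2 / 4 + B.trace ^ 2 / 4 - A.det - B.det - (A * B - B * A) 0 1 = 0 ↔
      ∃ μ γ θ φ : ℝ,
        (!![Real.cos θ, -Real.sin θ; Real.sin θ, Real.cos θ])ᵀ *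
            (Real.cos φ • A + Real.sin φ • B) *
            !![Real.cos θ, -Real.sin θ; Real.sin θ, Real.cos θ] =
          !![μ + 2 * γ, 0; 0, μ] ∧
        (!![Real.cos θ, -Real.sin θ; Real.sin θ, Real.cos θ])ᵀ *
            ((-Real.sin φ) • A + Real.cos φ • B) *
            !![Real.cos θ, -Real.sin θ; Real.sin θ, Real.cos θ] =
          !![0, γ; γ, 0] := by
  rw [hA.eq_fin_two, hB.eq_fin_two]
  generalize A 0 0 = a, A 0 1 = b, A 1 1 = c, B 0 0 = d, B 0 1 = e, B 1 1 = f
  rw [wintgen_defect_eq_zero_iff]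
  simp only [smul_add_smul_fin_two, rotation_conj_fin_two, of_fin_two_eq_iff]
  constructor
  · rintro ⟨h₁, h₂⟩
    obtain ⟨ρ, φ, hm, hn⟩ := exists_polar_coordinates ((a + c) / 2) ((d + f) / 2)
    obtain ⟨γ, α, hp, hq⟩ := exists_polar_coordinates
      (Real.cos φ * e - Real.sin φ * b) (Real.cos φ * b + Real.sin φ * e)
    obtain ⟨θ, rfl⟩ : ∃ θ, α = 2 * θ := ⟨α / 2, by ring⟩
    rw [Real.cos_two_mul'] at hp
    rw [Real.sin_two_mul] at hq
    refine ⟨ρ - γ, γ, θ, φ, ?_⟩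
    have hφ := Real.cos_sq_add_sin_sq φ
    have hθ := Real.cos_sq_add_sin_sq θ
    generalize Real.cos φ = x, Real.sin φ = y, Real.cos θ = u, Real.sin θ = v at *
    have ha : x * a + y * d = ρ + γ * (u ^ 2 - v ^ 2) := by
      linear_combination x * hm + y * hn + hp + ρ * hφ + x / 2 * h₁ + y / 2 * h₂
    have hc : x * c + y * f = ρ - γ * (u ^ 2 - v ^ 2) := by
      linear_combination x * hm + y * hn - hp + ρ * hφ - x / 2 * h₁ - y / 2 * h₂
    have hb : x * b + y * e = γ * (2 * v * u) := hq
    have hd : -y * a + x * d = -(γ * (2 * v * u)) := by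
      linear_combination x * hn - y * hm - hq - y / 2 * h₁ + x / 2 * h₂
    have hf : -y * c + x * f = γ * (2 * v * u) := by
      linear_combination x * hn - y * hm + hq + y / 2 * h₁ - x / 2 * h₂
    have he : -y * b + x * e = γ * (u ^ 2 - v ^ 2) := by linear_combination hp
    rw [ha, hb, hc, hd, he, hf]
    have hθ' : (u ^ 2 + v ^ 2) ^ 2 = 1 := by rw [hθ, one_pow]
    refine ⟨⟨?_, ?_, ?_, ?_⟩, ?_, ?_, ?_, ?_⟩
    · linear_combination ρ * hθ + γ * hθ'
    · ring
    · ring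
    · linear_combination ρ * hθ - γ * hθ'
    · ring
    · linear_combination γ * hθ'
    · linear_combination γ * hθ'
    · ring
  · rintro ⟨μ, γ, θ, φ, ⟨h₁, h₂, -, h₃⟩, h₄, h₅, -, h₆⟩
    have hφ := Real.cos_sq_add_sin_sq φ
    have hθ : (Real.cos θ ^ 2 - Real.sin θ ^ 2) ^ 2 + (2 * Real.sin θ * Real.cos θ) ^ 2 = 1 := by
      rw [← Real.cos_two_mul', ← Real.sin_two_mul, Real.cos_sq_add_sin_sq]
    generalize Real.cos φ = x, Real.sin φ = y, Real.cos θ = u, Real.sin θ = v at *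
    obtain ⟨h, h'⟩ := eq_zero_of_rotation_eq_zero
      (x := x * (a - c - 2 * e) + y * (2 * b + d - f))
      (y := x * (2 * b + d - f) - y * (a - c - 2 * e)) hθ
      (by linear_combination h₁ - h₃ - 2 * h₅) (by linear_combination 2 * h₂ + h₄ - h₆)
    exact eq_zero_of_rotation_eq_zero hφ h h'
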